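/- Let n ≥ 1 and b > 0. With the notation R(p, y) for the mean squared error of the IPW estimator under the Bernoulli design with probabilities p ∈ (0,1)ⁿ: (i) for every p ∈ (0,1)ⁿ there exist y(1), y(0) with every entry in [−b, b] (namely y_j(1) = y_j(0) = b for all j) such that R(p, y) ≥ 4b²/n; and (ii) if p_j = 1/2 for every j, then R(p, y) ≤ 4b²/n for all y(1), y(0) with every entry in [−b, b]. Hence the balanced Bernoulli design with treatment probability one half is minimax optimal over the uniform uncertainty set [−b, b]^{2n}, with minimax risk 4b²/n. -/

import Mathlib

open Finset

/-- The mean squared error of the IPW estimator under the Bernoulli design with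
unit-specific treatment probabilities `p` and potential outcomes `y1`, `y0`. -/
noncomputable def ipwMSE (n : ℕ) (p y1 y0 : Fin n → ℝ) : ℝ :=
  ∑ w : Fin n → Bool,
    (∏ j, if w j then p j else 1 - p j) *
      ((1 / (n : ℝ)) * ∑ j,
        (y1 j * (if w j = true then (1 : ℝ) else 0) / p j
          - y0 j * (if w j = false then (1 : ℝ) else 0) / (1 - p j))
        - (1 / (n : ℝ)) * ∑ j, (y1 j - y0 j)) ^ 2

theorem bern_second_moment : ∀ (n : ℕ) (q : Fin n → ℝ) (f : Fin n → Bool → ℝ) (c : ℝ),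
    (∀ j, q j * f j true + (1 - q j) * f j false = 0) →
    ∑ w : Fin n → Bool, (∏ j, if w j then q j else 1 - q j) * (c + ∑ j, f j (w j)) ^ 2
      = c ^ 2 + ∑ j, (q j * f j true ^ 2 + (1 - q j) * f j false ^ 2) := by
  intro n
  induction n with
  | zero => intro q f c _; simp
  | succ n ih =>
    intro q f c h
    rw [← (Fin.consEquiv (fun _ : Fin (n + 1) => Bool)).sum_comp, Fintype.sum_prod_type]
    have key : ∀ x : Bool, ∑ y : Fin n → Bool,
        (∏ j, if (Fin.consEquiv (fun _ : Fin (n + 1) => Bool)) (x, y) j then q j else 1 - q j) *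
          (c + ∑ j, f j ((Fin.consEquiv (fun _ : Fin (n + 1) => Bool)) (x, y) j)) ^ 2
        = (if x then q 0 else 1 - q 0) * ((c + f 0 x) ^ 2 +
          ∑ j : Fin n, (q j.succ * f j.succ true ^ 2 + (1 - q j.succ) * f j.succ false ^ 2)) := by
      intro x
      rw [← ih (fun j => q j.succ) (fun j => f j.succ) (c + f 0 x) (fun j => h j.succ),
        Finset.mul_sum]
      refine Finset.sum_congr rfl fun y _ => ?_
      simp only [Fin.consEquiv, Equiv.coe_fn_mk, Fin.prod_univ_succ, Fin.sum_univ_succ,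
        Fin.cons_zero, Fin.cons_succ]
      ring
    rw [Finset.sum_congr rfl fun x _ => key x, Fintype.sum_bool, Fin.sum_univ_succ]
    simp only [if_true, Bool.false_eq_true, if_false]
    linear_combination (2 * c) * h 0

theorem ipwMSE_eq (n : ℕ) (p y1 y0 : Fin n → ℝ) (hp : ∀ j, 0 < p j ∧ p j < 1) :
    ipwMSE n p y1 y0 = (1 / (n : ℝ)) ^ 2 * ∑ j,
      (p j * (y1 j / p j - (y1 j - y0 j)) ^ 2
        + (1 - p j) * (- (y0 j / (1 - p j)) - (y1 j - y0 j)) ^ 2) := by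
  have h := bern_second_moment n p (fun j x => if x then y1 j / p j - (y1 j - y0 j)
    else - (y0 j / (1 - p j)) - (y1 j - y0 j)) 0 (by
      intro j
      have h1 : p j ≠ 0 := (hp j).1.ne'
      have h2 : 1 - p j ≠ 0 := by linarith [(hp j).2]
      simp only [if_true, Bool.false_eq_true, if_false]
      field_simp
      ring)
  simp only [if_true, Bool.false_eq_true, if_false] at h
  rw [zero_pow two_ne_zero, zero_add] at h
  rw [← h, Finset.mul_sum, ipwMSE]
  refine Finset.sum_congr rfl fun w _ => ?_
  rw [← mul_sub, ← Finset.sum_sub_distrib, zero_add, mul_pow]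
  have : ∀ j, (y1 j * (if w j = true then (1 : ℝ) else 0) / p j
          - y0 j * (if w j = false then (1 : ℝ) else 0) / (1 - p j)) - (y1 j - y0 j)
      = if w j = true then y1 j / p j - (y1 j - y0 j)
        else - (y0 j / (1 - p j)) - (y1 j - y0 j) := by
    intro j
    cases w j <;> simp
  rw [Finset.sum_congr rfl fun j _ => this j]
  ring

/-- The balanced Bernoulli design with treatment probability one half is minimax optimal
over the uniform uncertainty set `[−b, b]^{2n}`, with minimax risk `4b²/n`. -/
theorem balanced_bernoulli_minimax
    (n : ℕ) (hn : 1 ≤ n) (b : ℝ) (hb : 0 < b) :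
    (∀ p : Fin n → ℝ, (∀ j, 0 < p j ∧ p j < 1) →
      ∃ y1 y0 : Fin n → ℝ, (∀ j, |y1 j| ≤ b) ∧ (∀ j, |y0 j| ≤ b) ∧
        (∀ j, y1 j = b) ∧ (∀ j, y0 j = b) ∧
        4 * b ^ 2 / (n : ℝ) ≤ ipwMSE n p y1 y0) ∧
    (∀ y1 y0 : Fin n → ℝ, (∀ j, |y1 j| ≤ b) → (∀ j, |y0 j| ≤ b) →
      ipwMSE n (fun _ => (1 : ℝ) / 2) y1 y0 ≤ 4 * b ^ 2 / (n : ℝ)) := by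
  have hn0 : (0 : ℝ) < n := by exact_mod_cast hn
  have hval : 4 * b ^ 2 / (n : ℝ) = (1 / (n : ℝ)) ^ 2 * ∑ _j : Fin n, 4 * b ^ 2 := by
    simp only [Finset.sum_const, Finset.card_univ, Fintype.card_fin, nsmul_eq_mul]
    field_simp
  constructor
  · intro p hp
    refine ⟨fun _ => b, fun _ => b, fun _ => (abs_of_pos hb).le, fun _ => (abs_of_pos hb).le,
      fun _ => rfl, fun _ => rfl, ?_⟩
    rw [ipwMSE_eq n p _ _ hp, hval]
    refine mul_le_mul_of_nonneg_left (Finset.sum_le_sum fun j _ => ?_) (sq_nonneg _)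
    have h1 : 0 < p j := (hp j).1
    have h2 : 0 < 1 - p j := by linarith [(hp j).2]
    have h3 : p j * (b / p j - (b - b)) ^ 2 + (1 - p j) * (- (b / (1 - p j)) - (b - b)) ^ 2
        = b ^ 2 / (p j * (1 - p j)) := by
      field_simp
      ring
    rw [h3, le_div_iff₀ (mul_pos h1 h2)]
    nlinarith [sq_nonneg (b * (2 * p j - 1))]
  · intro y1 y0 h1 h0
    rw [ipwMSE_eq n _ _ _ (fun _ => by norm_num), hval]
    refine mul_le_mul_of_nonneg_left (Finset.sum_le_sum fun j _ => ?_) (sq_nonneg _)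
    have a1 := abs_le.mp (h1 j)
    have a0 := abs_le.mp (h0 j)
    have : (y1 j + y0 j) ^ 2 ≤ (2 * b) ^ 2 := sq_le_sq' (by linarith) (by linarith)
    have e : (1 : ℝ) / 2 * (y1 j / (1 / 2) - (y1 j - y0 j)) ^ 2
        + (1 - 1 / 2) * (- (y0 j / (1 - 1 / 2)) - (y1 j - y0 j)) ^ 2 = (y1 j + y0 j) ^ 2 := by
      ring
    rw [e]
    linarith
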